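/- (Noisy, subsampled data: filterbank-domain decomposition) Let {g_i, h_i}_{i∈{0,1}} be a perfect reconstruction filterbank with finitely supported filters that satisfies the analysis–synthesis symmetry with parameters (a,b). Let x, ξ : ℤ → ℝ and let y = x_s + ξ_s. Then for every number of levels L ≥ 1, every bit vector 𝐢 ∈ {0,1}^L with level-0 bit i_0, and every n ∈ ℤ: v^y_𝐢[n] = (1/2)·(v^x_𝐢[n] + (−1)^{i_0}·w^x_{𝐢′}[n]) + (1/2)·(v^ξ_𝐢[n] + (−1)^{i_0}·w^ξ_{𝐢′}[n]). -/

import Mathlib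

open scoped BigOperators

noncomputable section

/-- Discrete convolution `(f ⋆ x)[n] = Σ_m f[m]·x[n−m]` (a finite sum when `f` is
finitely supported). -/
def conv (f x : ℤ → ℝ) (n : ℤ) : ℝ := ∑ᶠ m : ℤ, f m * x (n - m)

/-- One-level filterbank coefficient `v^x_i[n] = (g_i ⋆ x)[2n]`. -/
def fbCoeff (g x : ℤ → ℝ) (n : ℤ) : ℝ := conv g x (2 * n)

/-- Perfect reconstruction filterbank:
`x[n] = Σ_{i∈{0,1}} Σ_m h_i[n−2m]·v^x_i[m]` for all `x` and `n`. -/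
def IsPR (g h : ZMod 2 → ℤ → ℝ) : Prop :=
  ∀ (x : ℤ → ℝ) (n : ℤ),
    x n = ∑ i : ZMod 2, ∑ᶠ m : ℤ, h i (n - 2 * m) * fbCoeff (g i) x m

/-- Discrete-time Fourier transform `f̂(ω) = Σ_n f[n]·exp(−i·n·ω)`. -/
def dtft (f : ℤ → ℝ) (ω : ℝ) : ℂ :=
  ∑ᶠ n : ℤ, (f n : ℂ) * Complex.exp (-(Complex.I * (n : ℂ) * (ω : ℂ)))

/-- Analysis–synthesis symmetry with parameters `(a, b)`:
`ĝ_i(ω) = (−1)^{1−i}·a·exp(i(2b+1)ω)·ĥ_{1−i}(ω−π)`. -/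
def SymmAS (g h : ZMod 2 → ℤ → ℝ) (a : ℝ) (b : ℤ) : Prop :=
  ∀ (i : ZMod 2) (ω : ℝ),
    dtft (g i) ω
      = (-1 : ℂ) ^ (1 - i : ZMod 2).val * (a : ℂ)
        * Complex.exp (Complex.I * (2 * (b : ℂ) + 1) * (ω : ℂ))
        * dtft (h (1 - i)) (ω - Real.pi)

/-- Complementary analysis filter `g̃_i[n] = a·h_i[n + 2b + 1]`. -/
def compG (a : ℝ) (b : ℤ) (h : ℤ → ℝ) (n : ℤ) : ℝ := a * h (n + (2 * b + 1))

/-- Complementary synthesis filter `h̃_i[n] = a⁻¹·g_i[n − (2b + 1)]`. -/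
def compH (a : ℝ) (b : ℤ) (g : ℤ → ℝ) (n : ℤ) : ℝ := a⁻¹ * g (n - (2 * b + 1))

/-- Modulated sequence `x_m[n] = (−1)^n·x[n]`. -/
def modSeq (x : ℤ → ℝ) (n : ℤ) : ℝ := (-1 : ℝ) ^ n * x n

/-- Subsampled sequence: `x_s[n] = x[n]` for even `n`, and `0` for odd `n`. -/
def subSeq (x : ℤ → ℝ) (n : ℤ) : ℝ := if Even n then x n else 0

/-- Haar analysis filters: `g_i[0] = 1`, `g_i[−1] = (−1)^i`, else `0`. -/
def haarG (i : ZMod 2) (n : ℤ) : ℝ :=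
  if n = 0 then 1 else if n = -1 then (-1 : ℝ) ^ i.val else 0

/-- Haar synthesis filters: `h_i[0] = 1/2`, `h_i[1] = (−1)^i/2`, else `0`. -/
def haarH (i : ZMod 2) (n : ℤ) : ℝ :=
  if n = 0 then 1 / 2 else if n = 1 then (-1 : ℝ) ^ i.val / 2 else 0

/-- `L`-level filterbank coefficients `v^x_𝐢`; the bit `𝐢 0` is the level-0 bit,
applied first, then the remaining levels recursively. -/
def mCoeff (g : ZMod 2 → ℤ → ℝ) : (L : ℕ) → (Fin L → ZMod 2) → (ℤ → ℝ) → ℤ → ℝ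
  | 0, _, x => x
  | L + 1, i, x => mCoeff g L (fun t => i t.succ) (fbCoeff (g (i 0)) x)

/-- `L`-level complementary coefficients `w^x_𝐢`: identical to `mCoeff` except that
the level-0 filter is taken from the complementary bank `gt`. -/
def mCoeffW (g gt : ZMod 2 → ℤ → ℝ) : (L : ℕ) → (Fin L → ZMod 2) → (ℤ → ℝ) → ℤ → ℝ
  | 0, _, x => x
  | L + 1, i, x => mCoeff g L (fun t => i t.succ) (fbCoeff (gt (i 0)) x)

/-- `𝐢′`: flip the level-0 bit of `𝐢`. -/
def flip0 {L : ℕ} (i : Fin (L + 1) → ZMod 2) : Fin (L + 1) → ZMod 2 :=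
  Function.update i 0 (1 - i 0)

/-- The character `ω ↦ exp (-i n ω)` of the real line. -/
def dtftChar (n : ℤ) : Multiplicative ℝ →* ℂ where
  toFun ω := Complex.exp (-(Complex.I * (n : ℂ) * ((Multiplicative.toAdd ω : ℝ) : ℂ)))
  map_one' := by simp
  map_mul' u v := by
    rw [← Complex.exp_add, toAdd_mul]
    push_cast
    ring_nf

lemma dtftChar_injective : Function.Injective dtftChar := by
  intro n m hnm
  by_contra hne
  have hd : ((n : ℂ) - m) ≠ 0 := sub_ne_zero.2 (by exact_mod_cast hne)
  have h := DFunLike.congr_fun hnm (Multiplicative.ofAdd (Real.pi / ((n : ℝ) - m)))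
  simp only [dtftChar, MonoidHom.coe_mk, OneHom.coe_mk, toAdd_ofAdd] at h
  have hsplit : -(Complex.I * (m : ℂ) * ((Real.pi / ((n : ℝ) - m) : ℝ) : ℂ))
      = -(Complex.I * (n : ℂ) * ((Real.pi / ((n : ℝ) - m) : ℝ) : ℂ))
        + Real.pi * Complex.I := by
    push_cast
    field_simp
    ring
  rw [hsplit, Complex.exp_add, Complex.exp_pi_mul_I] at h
  have h0 := Complex.exp_ne_zero (-(Complex.I * (n : ℂ) * ((Real.pi / ((n : ℝ) - m) : ℝ) : ℂ)))
  exact h0 (by linear_combination h / 2)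

lemma dtft_eq_sum {f : ℤ → ℝ} {s : Finset ℤ} (hs : Function.support f ⊆ s) (ω : ℝ) :
    dtft f ω = ∑ n ∈ s, (f n : ℂ) * dtftChar n (Multiplicative.ofAdd ω) := by
  refine finsum_eq_sum_of_support_subset _ fun n hn => hs fun h0 => hn ?_
  simp [h0]

/-- A finitely supported filter is determined by its discrete-time Fourier transform. -/
lemma eq_of_dtft_eq {f g : ℤ → ℝ} (hf : (Function.support f).Finite)
    (hg : (Function.support g).Finite) (h : ∀ ω, dtft f ω = dtft g ω) : f = g := by
  classical
  have hli := (linearIndependent_monoidHom (Multiplicative ℝ) ℂ).comp dtftChar dtftChar_injective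
  rw [linearIndependent_iff'] at hli
  set s := hf.toFinset ∪ hg.toFinset
  have hfs : Function.support f ⊆ s := fun n hn => by simp [s, Function.mem_support.1 hn]
  have hgs : Function.support g ⊆ s := fun n hn => by simp [s, Function.mem_support.1 hn]
  have hz := hli s (fun n => (f n : ℂ) - g n) <| by
    funext ω
    have hω := h (Multiplicative.toAdd ω)
    rw [dtft_eq_sum hfs, dtft_eq_sum hgs, ← sub_eq_zero, ← Finset.sum_sub_distrib] at hω
    simpa [sub_mul] using hω
  funext n
  by_cases hn : n ∈ s
  · exact_mod_cast sub_eq_zero.1 (hz n hn)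
  · rw [Function.notMem_support.1 fun h' => hn (hfs h'),
      Function.notMem_support.1 fun h' => hn (hgs h')]

lemma support_compG_finite {h : ℤ → ℝ} (hh : (Function.support h).Finite) (a : ℝ) (b : ℤ) :
    (Function.support (compG a b h)).Finite := by
  refine (hh.preimage (add_left_injective (2 * b + 1)).injOn).subset fun n hn h0 => hn ?_
  simp [compG, h0]

lemma support_modSeq_finite {f : ℤ → ℝ} (hf : (Function.support f).Finite) :
    (Function.support (modSeq f)).Finite :=
  hf.subset fun n hn h0 => hn (by simp [modSeq, h0])

lemma dtft_const_mul (c : ℝ) (f : ℤ → ℝ) (ω : ℝ) :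
    dtft (fun n => c * f n) ω = c * dtft f ω := by
  simp only [dtft, Complex.ofReal_mul, mul_assoc]
  exact (smul_finsum (c : ℂ) _).symm

lemma dtft_shift (f : ℤ → ℝ) (k : ℤ) (ω : ℝ) :
    dtft (fun n => f (n + k)) ω = Complex.exp (Complex.I * k * ω) * dtft f ω := by
  rw [dtft, dtft, ← smul_eq_mul, smul_finsum]
  conv_rhs => rw [← finsum_comp_equiv (Equiv.addRight k)]
  refine finsum_congr fun n => ?_
  rw [Equiv.coe_addRight, smul_eq_mul, mul_left_comm, ← Complex.exp_add]
  push_cast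
  ring_nf

lemma dtft_modSeq (f : ℤ → ℝ) (ω : ℝ) : dtft (modSeq f) ω = dtft f (ω - Real.pi) := by
  refine finsum_congr fun n => ?_
  have hexp : Complex.exp (-(Complex.I * n * ((ω - Real.pi : ℝ) : ℂ)))
      = (-1) ^ n * Complex.exp (-(Complex.I * n * ω)) := by
    rw [← Complex.exp_pi_mul_I, ← Complex.exp_int_mul, ← Complex.exp_add]
    push_cast
    ring_nf
  rw [hexp, modSeq]
  push_cast
  ring

/-- The time-domain form of the analysis–synthesis symmetry. -/
lemma SymmAS.apply_eq {g h : ZMod 2 → ℤ → ℝ} {a : ℝ} {b : ℤ}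
    (hsym : SymmAS g h a b) (hg : ∀ i, (Function.support (g i)).Finite)
    (hh : ∀ i, (Function.support (h i)).Finite) (i : ZMod 2) (n : ℤ) :
    g i n = (-1 : ℝ) ^ i.val * modSeq (compG a b (h (1 - i))) n := by
  have hm : (Function.support (modSeq (h (1 - i)))).Finite := support_modSeq_finite (hh _)
  have key := eq_of_dtft_eq
    (g := fun n => (-1) ^ (1 - i).val * compG a b (modSeq (h (1 - i))) n) (hg i)
    ((support_compG_finite hm a b).subset (Function.support_mul_subset_right _ _))
    fun ω => by
      rw [hsym i ω, dtft_const_mul]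
      unfold compG
      rw [dtft_const_mul, dtft_shift, dtft_modSeq]
      push_cast
      ring
  rw [key]
  have hpow : (-1 : ℝ) ^ (n + (2 * b + 1)) = -(-1 : ℝ) ^ n := by
    rw [zpow_add₀ (by norm_num), zpow_add₀ (by norm_num), zpow_mul]
    norm_num
  simp only [compG, modSeq, hpow]
  have hsign : (-1 : ℝ) ^ (1 - i).val = -(-1 : ℝ) ^ i.val := by
    obtain rfl | rfl : i = 0 ∨ i = 1 := (by decide : ∀ j : ZMod 2, j = 0 ∨ j = 1) i
    · simp [ZMod.val_one]
    · simp [ZMod.val_one]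
  rw [hsign]
  ring

lemma conv_summand_support_finite {f : ℤ → ℝ} (hf : (Function.support f).Finite)
    (x : ℤ → ℝ) (n : ℤ) : (Function.support fun m => f m * x (n - m)).Finite :=
  hf.subset (Function.support_mul_subset_left _ _)

lemma fbCoeff_add {f : ℤ → ℝ} (hf : (Function.support f).Finite) (x y : ℤ → ℝ) :
    fbCoeff f (x + y) = fbCoeff f x + fbCoeff f y := by
  funext n
  simp only [fbCoeff, conv, Pi.add_apply, mul_add]
  exact finsum_add_distrib (conv_summand_support_finite hf x _)
    (conv_summand_support_finite hf y _)

lemma fbCoeff_smul (f : ℤ → ℝ) (c : ℝ) (x : ℤ → ℝ) :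
    fbCoeff f (c • x) = c • fbCoeff f x := by
  funext n
  simp only [fbCoeff, conv, Pi.smul_apply, smul_eq_mul, mul_left_comm]
  exact (mul_finsum _ c).symm

lemma mCoeff_add {g : ZMod 2 → ℤ → ℝ} (hg : ∀ i, (Function.support (g i)).Finite) (L : ℕ)
    (i : Fin L → ZMod 2) (x y : ℤ → ℝ) :
    mCoeff g L i (x + y) = mCoeff g L i x + mCoeff g L i y := by
  induction L generalizing x y with
  | zero => rfl
  | succ L ih => simp only [mCoeff, fbCoeff_add (hg _), ih]

lemma mCoeff_smul (g : ZMod 2 → ℤ → ℝ) (L : ℕ) (i : Fin L → ZMod 2) (c : ℝ) (x : ℤ → ℝ) :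
    mCoeff g L i (c • x) = c • mCoeff g L i x := by
  induction L generalizing x with
  | zero => rfl
  | succ L ih => simp only [mCoeff, fbCoeff_smul, ih]

/-- One-level coefficients of a subsampled sequence, for a filter which is a modulation of
another one up to a constant factor. -/
lemma fbCoeff_subSeq {f f' : ℤ → ℝ} (hf : (Function.support f).Finite)
    (hf' : (Function.support f').Finite) (c : ℝ) (hff' : ∀ n, f n = c * modSeq f' n)
    (x : ℤ → ℝ) :
    fbCoeff f (subSeq x) = (1 / 2 : ℝ) • (fbCoeff f x + c • fbCoeff f' x) := by
  funext n
  simp only [fbCoeff, conv, Pi.smul_apply, Pi.add_apply]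
  have hfin : (Function.support fun m => c • (f' m * x (2 * n - m))).Finite :=
    (conv_summand_support_finite hf' x _).subset (Function.support_const_smul_subset c _)
  rw [smul_finsum, ← finsum_add_distrib (conv_summand_support_finite hf x _) hfin, smul_finsum]
  refine finsum_congr fun m => ?_
  simp only [hff', modSeq, subSeq, smul_eq_mul]
  rcases Int.even_or_odd m with hm | hm
  · rw [if_pos ((even_two_mul n).sub hm), hm.neg_one_zpow]
    ring
  · rw [if_neg (Int.not_even_iff_odd.2 ((even_two_mul n).sub_odd hm)), hm.neg_one_zpow]
    ring

/-- Noisy, subsampled data: filterbank-domain decomposition. -/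
theorem noisy_subsampled_decomposition (g h : ZMod 2 → ℤ → ℝ)
    (hg : ∀ i : ZMod 2, (Function.support (g i)).Finite)
    (hh : ∀ i : ZMod 2, (Function.support (h i)).Finite)
    (a : ℝ) (b : ℤ) (ha : a ≠ 0)
    (hPR : IsPR g h) (hsym : SymmAS g h a b)
    (x ξ : ℤ → ℝ) (y : ℤ → ℝ) (hy : ∀ n : ℤ, y n = subSeq x n + subSeq ξ n)
    (L : ℕ) (i : Fin (L + 1) → ZMod 2) (n : ℤ) :
    mCoeff g (L + 1) i y n
      = (1 / 2) * (mCoeff g (L + 1) i x n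
          + (-1 : ℝ) ^ (i 0).val
            * mCoeffW g (fun k => compG a b (h k)) (L + 1) (flip0 i) x n)
        + (1 / 2) * (mCoeff g (L + 1) i ξ n
          + (-1 : ℝ) ^ (i 0).val
            * mCoeffW g (fun k => compG a b (h k)) (L + 1) (flip0 i) ξ n) := by
  have hsub (z : ℤ → ℝ) : mCoeff g (L + 1) i (subSeq z)
      = (1 / 2 : ℝ) • (mCoeff g (L + 1) i z
        + (-1 : ℝ) ^ (i 0).val
          • mCoeffW g (fun k => compG a b (h k)) (L + 1) (flip0 i) z) := by
    have hflip : flip0 i 0 = 1 - i 0 := Function.update_self ..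
    have htail : (fun t : Fin L => flip0 i t.succ) = fun t => i t.succ :=
      funext fun t => Function.update_of_ne (Fin.succ_ne_zero t) ..
    simp only [mCoeff, mCoeffW, hflip, htail]
    rw [fbCoeff_subSeq (hg _) (support_compG_finite (hh (1 - i 0)) a b) _
      (hsym.apply_eq hg hh (i 0)), mCoeff_smul, mCoeff_add hg, mCoeff_smul]
  rw [show y = subSeq x + subSeq ξ from funext hy, mCoeff_add hg, hsub, hsub]
  rfl
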